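/- Let p ∈ ℂ[x] be nonzero with n = deg p and c ∈ ℂ such that p(x) = (−1)^n p(−x + c). If k ≥ 1 and a ∈ (𝒟_p^±)_{−k} satisfies [a, b] = 0 for every b ∈ (𝒟_p^±)_1, then a = 0. (That is, the graded Lie algebra 𝒟_p^± satisfies property (P2).) -/

import Mathlib

noncomputable section

/-- ℂ[t,t⁻¹] as a ℂ-vector space with basis {t^j}_{j∈ℤ}; t^j is `Finsupp.single j 1`. -/
abbrev LaurentV : Type := ℤ →₀ ℂ

/-- The regular differential operator `t^k f(D)` (where D = t·d/dt), acting by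
t^j ↦ f(j)·t^{j+k}. -/
def op (k : ℤ) (f : Polynomial ℂ) : Module.End ℂ LaurentV :=
  Finsupp.lsum ℂ fun j => f.eval (j : ℂ) • Finsupp.lsingle (j + k)

/-- The graded piece (𝒟ᵃ_p)_j = {t^j f(D) p(D) : f ∈ ℂ[x]}. -/
def Dgrade (p : Polynomial ℂ) (j : ℤ) : Submodule ℂ (Module.End ℂ LaurentV) :=
  Submodule.span ℂ {A | ∃ f : Polynomial ℂ, A = op j (f * p)}

/-- 𝒟ᵃ_p = 𝒟ᵃ·p(D). -/
def Dp (p : Polynomial ℂ) : Submodule ℂ (Module.End ℂ LaurentV) :=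
  Submodule.span ℂ {A | ∃ (k : ℤ) (f : Polynomial ℂ), A = op k (f * p)}

/-- σ is an anti-involution: it is ℂ-linear (built into the type), involutive, and
reverses products. -/
def IsAntiInvolutionOn (p : Polynomial ℂ) (σ : ↥(Dp p) →ₗ[ℂ] ↥(Dp p)) : Prop :=
  (∀ A : ↥(Dp p), σ (σ A) = A) ∧
  (∀ A B W : ↥(Dp p),
    (W : Module.End ℂ LaurentV) = (A : Module.End ℂ LaurentV) * (B : Module.End ℂ LaurentV) →
    ((σ W : Module.End ℂ LaurentV)) = (σ B : Module.End ℂ LaurentV) * (σ A : Module.End ℂ LaurentV))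

/-- σ preserves the principal ℤ-gradation. -/
def PreservesGrading (p : Polynomial ℂ) (σ : ↥(Dp p) →ₗ[ℂ] ↥(Dp p)) : Prop :=
  ∀ (j : ℤ) (A : ↥(Dp p)), (A : Module.End ℂ LaurentV) ∈ Dgrade p j →
    ((σ A : Module.End ℂ LaurentV)) ∈ Dgrade p j

/-- σ(t^k f(D) p(D)) = (-1)^{deg p}·e^k·t^k f(−D−k+c)p(D). -/
def SigmaFormula (p : Polynomial ℂ) (c e : ℂ) (σ : ↥(Dp p) →ₗ[ℂ] ↥(Dp p)) : Prop :=
  ∀ (k : ℤ) (f : Polynomial ℂ) (A : ↥(Dp p)), (A : Module.End ℂ LaurentV) = op k (f * p) →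
    ((σ A : Module.End ℂ LaurentV)) =
      ((-1 : ℂ) ^ p.natDegree * e ^ k) •
        op k ((f.comp (Polynomial.C (c - (k : ℂ)) - Polynomial.X)) * p)

/-- The graded piece (𝒟_p^±)_k = {d ∈ (𝒟_p)_k : σ_±(d) = −d}, as a set. -/
def DpmGradeSet (p : Polynomial ℂ) (c e : ℂ) (k : ℤ) : Set (Module.End ℂ LaurentV) :=
  {A | ∃ f : Polynomial ℂ, A = op k (f * p) ∧
    ((-1 : ℂ) ^ p.natDegree * e ^ k) •
      op k ((f.comp (Polynomial.C (c - (k : ℂ)) - Polynomial.X)) * p) = -A}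

/-- The graded piece (𝒟_p^±)_k, as a ℂ-subspace. -/
def DpmGrade (p : Polynomial ℂ) (c e : ℂ) (k : ℤ) : Submodule ℂ (Module.End ℂ LaurentV) :=
  Submodule.span ℂ (DpmGradeSet p c e k)

/-- V has finite codimension in W. -/
def FinCodimIn {M : Type*} [AddCommGroup M] [Module ℂ M] (V W : Submodule ℂ M) : Prop :=
  FiniteDimensional ℂ (↥W ⧸ Submodule.comap W.subtype V)

open Polynomial

theorem op_single (k : ℤ) (f : ℂ[X]) (j : ℤ) (z : ℂ) :
    op k f (Finsupp.single j z) = Finsupp.single (j + k) (f.eval (j : ℂ) * z) := by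
  simp [op]

theorem op_add (k : ℤ) (f g : ℂ[X]) : op k (f + g) = op k f + op k g := by
  refine Finsupp.lhom_ext fun j z => ?_
  simp [op_single, add_mul, Finsupp.single_add]

theorem op_smul (k : ℤ) (r : ℂ) (f : ℂ[X]) : op k (r • f) = r • op k f := by
  refine Finsupp.lhom_ext fun j z => ?_
  simp [op_single, mul_assoc, -Finsupp.single_mul]

theorem op_zero (k : ℤ) : op k 0 = 0 := by
  simpa using op_smul k 0 0

theorem op_mul_op (k l : ℤ) (f g : ℂ[X]) :
    op k f * op l g = op (k + l) (f.comp (X + C (l : ℂ)) * g) := by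
  refine Finsupp.lhom_ext fun j z => ?_
  simp [op_single, mul_assoc, add_comm k l, add_assoc, -Finsupp.single_mul]

theorem op_injective (k : ℤ) : Function.Injective (op k) := by
  intro f g h
  refine Polynomial.eq_of_infinite_eval_eq f g
    ((Set.infinite_range_of_injective (Int.cast_injective (α := ℂ))).mono ?_)
  rintro _ ⟨j, rfl⟩
  have hj := LinearMap.congr_fun h (Finsupp.single j 1)
  rw [op_single, op_single] at hj
  simpa using Finsupp.single_injective _ hj

theorem exists_eq_op_of_mem_DpmGrade {p : ℂ[X]} {c e : ℂ} {k : ℤ}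
    {a : Module.End ℂ LaurentV} (ha : a ∈ DpmGrade p c e k) : ∃ f, a = op k f := by
  induction ha using Submodule.span_induction with
  | mem x hx => exact ⟨_, hx.choose_spec.1⟩
  | zero => exact ⟨0, (op_zero k).symm⟩
  | add x y _ _ hx hy =>
    obtain ⟨f, rfl⟩ := hx
    obtain ⟨g, rfl⟩ := hy
    exact ⟨f + g, (op_add k f g).symm⟩
  | smul r x _ hx =>
    obtain ⟨f, rfl⟩ := hx
    exact ⟨r • f, (op_smul k r f).symm⟩

/-- Powers of `D - (c - 1) / 2` of the right parity give elements of degree one. -/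
theorem op_one_pow_mul_mem_DpmGrade (p : ℂ[X]) (c e : ℂ) (i : ℕ)
    (hi : (-1 : ℂ) ^ p.natDegree * e * (-1) ^ i = -1) :
    op 1 ((X - C ((c - 1) / 2)) ^ i * p) ∈ DpmGrade p c e 1 := by
  refine Submodule.subset_span ⟨_, rfl, ?_⟩
  have hcomp : ((X - C ((c - 1) / 2)) ^ i).comp (C (c - ((1 : ℤ) : ℂ)) - X) =
      ((-1 : ℂ) ^ i) • (X - C ((c - 1) / 2)) ^ i := by
    refine Polynomial.funext fun x => ?_
    simp only [eval_comp, eval_pow, eval_sub, eval_X, eval_C, eval_smul, smul_eq_mul, Int.cast_one]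
    rw [← mul_pow]
    ring
  rw [hcomp, smul_mul_assoc, op_smul, smul_smul, zpow_one, hi]
  exact LinearMap.ext fun v => by simp

theorem mul_comp_eq_of_commute {k : ℤ} {f g : ℂ[X]} (h : ⁅op (-k) f, op 1 g⁆ = 0) :
    f.comp (X + 1) * g = g.comp (X - C (k : ℂ)) * f := by
  rw [Ring.lie_def, sub_eq_zero, op_mul_op, op_mul_op, add_comm 1 (-k)] at h
  simpa [sub_eq_add_neg] using op_injective _ h

theorem Dpm_P2 (p : Polynomial ℂ) (hp : p ≠ 0) (c : ℂ)
    (hpc : ∀ x : ℂ, p.eval x = (-1 : ℂ) ^ p.natDegree * p.eval (-x + c))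
    (e : ℂ) (he : e = 1 ∨ e = -1)
    (k : ℤ) (hk : 1 ≤ k) (a : Module.End ℂ LaurentV) (ha : a ∈ DpmGrade p c e (-k))
    (hcomm : ∀ b ∈ DpmGrade p c e 1, ⁅a, b⁆ = 0) :
    a = 0 := by
  obtain ⟨f, rfl⟩ := exists_eq_op_of_mem_DpmGrade ha
  obtain ⟨i, hi⟩ : ∃ i : ℕ, (-1 : ℂ) ^ p.natDegree * e * (-1) ^ i = -1 := by
    rcases neg_one_pow_eq_or ℂ p.natDegree with h | h <;> rcases he with rfl | rfl <;> rw [h]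
    · exact ⟨1, by norm_num⟩
    · exact ⟨0, by norm_num⟩
    · exact ⟨0, by norm_num⟩
    · exact ⟨1, by norm_num⟩
  set y : ℂ[X] := X - C ((c - 1) / 2) with hy
  have hk0 : (k : ℂ) ≠ 0 := by
    exact_mod_cast (by omega : k ≠ 0)
  have hycomp : y.comp (X - C (k : ℂ)) = y - C (k : ℂ) := by
    simp only [hy, sub_comp, X_comp, C_comp]
    ring
  have hlow := mul_comp_eq_of_commute (hcomm _ (op_one_pow_mul_mem_DpmGrade p c e i hi))
  have hhigh := mul_comp_eq_of_commute
    (hcomm _ (op_one_pow_mul_mem_DpmGrade p c e (i + 2) (by rw [pow_add]; simpa using hi)))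
  rw [← hy, mul_comp, pow_comp, hycomp] at hlow hhigh
  have hprod : (y ^ 2 - (y - C (k : ℂ)) ^ 2) *
      ((y - C (k : ℂ)) ^ i * p.comp (X - C (k : ℂ)) * f) = 0 := by
    linear_combination hhigh - y ^ 2 * hlow
  have hysub : y - C (k : ℂ) ≠ 0 := by
    rw [hy, sub_sub, ← C_add]
    exact X_sub_C_ne_zero _
  have hsq : y ^ 2 - (y - C (k : ℂ)) ^ 2 ≠ 0 := by
    intro h
    have h' := congrArg (eval ((c - 1) / 2)) h
    simp [hy, hk0] at h'
  have hpcomp : p.comp (X - C (k : ℂ)) ≠ 0 := by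
    intro h
    have h' := congrArg (fun q => q.comp (X + C (k : ℂ))) h
    simp [comp_assoc, hp] at h'
  have hf : f = 0 := by
    exact (mul_eq_zero.mp hprod |>.resolve_left hsq |> mul_eq_zero.mp).resolve_left
      (mul_ne_zero (pow_ne_zero i hysub) hpcomp)
  rw [hf, op_zero]

end
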